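/- Fix an integer N ≥ 2 and let μ be a non-atomic Borel probability measure on [0,1] such that F_{N,0} is differentiable with bounded derivative on [0,1]. Define f_{N,n}(x) := (x+N−1)·F'_{N,n}(x). Then for every n ∈ ℕ and x ∈ [0,1], f_{N,n+1}(x) = Σ_{i≥N} P_{N,i}(x) · f_{N,n}(u_{N,i}(x)), where P_{N,i}(x) = (x+N−1)/((x+i)(x+i−1)) and u_{N,i}(x) = 1 − N/(x+i). -/

import Mathlib

open MeasureTheory Set Filter

/-- The Rényi-type continued fraction transformation
`R_N(x) = N/(1-x) - ⌊N/(1-x)⌋` for `x ≠ 1`, and `R_N(1) = 0`. -/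
noncomputable def renyiMap (N : ℕ) (x : ℝ) : ℝ :=
  if x = 1 then 0 else Int.fract ((N : ℝ) / (1 - x))

/-- `F_{N,n}(x) = μ {y ∈ [0,1] : R_N^n(y) ≤ x}`. -/
noncomputable def Fdist (N : ℕ) (μ : Measure ℝ) (n : ℕ) (x : ℝ) : ℝ :=
  (μ {y ∈ Icc (0 : ℝ) 1 | (renyiMap N)^[n] y ≤ x}).toReal

/-- `f_{N,n}(x) = (x+N-1) F'_{N,n}(x)`. -/
noncomputable def fDens (N : ℕ) (μ : Measure ℝ) (n : ℕ) (x : ℝ) : ℝ :=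
  (x + N - 1) * derivWithin (Fdist N μ n) (Icc 0 1) x

/-- Termwise differentiation within a set of a series whose terms are Lipschitz at the base point
with summable constants. -/
lemma hasDerivWithinAt_tsum_of_lipschitz {g : ℕ → ℝ → ℝ} {g' c : ℕ → ℝ} {s : Set ℝ} {x : ℝ}
    (hx : x ∈ s) (hc : Summable c) (hsum : ∀ y ∈ s, Summable fun j => g j y)
    (hlip : ∀ j, ∀ y ∈ s, |g j y - g j x| ≤ c j * |y - x|)
    (hg : ∀ j, HasDerivWithinAt (g j) (g' j) s x) :
    HasDerivWithinAt (fun y => ∑' j, g j y) (∑' j, g' j) s x := by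
  rw [hasDerivWithinAt_iff_tendsto_slope]
  have key : Tendsto (fun y => ∑' j, slope (g j) x y) (nhdsWithin x (s \ {x}))
      (nhds (∑' j, g' j)) := by
    refine tendsto_tsum_of_dominated_convergence (bound := c) hc
      (fun j => hasDerivWithinAt_iff_tendsto_slope.1 (hg j)) ?_
    filter_upwards [self_mem_nhdsWithin] with y hy j
    have hpos : 0 < |y - x| := abs_pos.2 (sub_ne_zero.2 hy.2)
    rw [slope_def_field, Real.norm_eq_abs, abs_div, div_le_iff₀ hpos]
    exact hlip j y hy.1
  refine key.congr' ?_
  filter_upwards [self_mem_nhdsWithin] with y hy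
  simp only [slope_def_field]
  rw [tsum_div_const, (hsum y hy.1).tsum_sub (hsum x hx)]

/-- The inverse branch `u_{N,j+N}` of the Rényi-type map. -/
noncomputable def renyiBranch (N j : ℕ) (x : ℝ) : ℝ :=
  1 - (N : ℝ) / (x + ((j + N : ℕ) : ℝ))

lemma renyiBranch_one (N j : ℕ) : renyiBranch N j 1 = renyiBranch N (j + 1) 0 := by
  unfold renyiBranch
  push_cast
  ring_nf

lemma summable_branch_const (N : ℕ) : Summable fun j : ℕ => (N : ℝ) / ((j + N : ℕ) : ℝ) ^ 2 := by
  have h : Summable fun i : ℕ => (N : ℝ) * (1 / (i : ℝ) ^ 2) :=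
    (Real.summable_one_div_nat_pow.2 one_lt_two).mul_left _
  simpa only [mul_one_div] using (summable_nat_add_iff N).2 h

lemma branch_denom_pos {N : ℕ} (hN : 2 ≤ N) (j : ℕ) {x : ℝ} (hx : 0 ≤ x) : 0 < x + ((j + N : ℕ) : ℝ) := by
  have : 0 < ((j + N : ℕ) : ℝ) := by exact_mod_cast (by omega : 0 < j + N)
  linarith

lemma renyiBranch_mem_Icc {N : ℕ} (hN : 2 ≤ N) (j : ℕ) {x : ℝ} (hx : x ∈ Icc (0 : ℝ) 1) :
    renyiBranch N j x ∈ Icc (0 : ℝ) 1 := by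
  have hp := branch_denom_pos hN j hx.1
  have hle : (N : ℝ) / (x + ((j + N : ℕ) : ℝ)) ≤ 1 := by
    rw [div_le_one hp]
    push_cast
    have := hx.1
    have : (0 : ℝ) ≤ j := j.cast_nonneg
    linarith
  have : 0 ≤ (N : ℝ) / (x + ((j + N : ℕ) : ℝ)) := by positivity
  constructor <;> unfold renyiBranch <;> linarith

lemma renyiBranch_mono {N : ℕ} (hN : 2 ≤ N) (j : ℕ) {x y : ℝ} (hx : 0 ≤ x) (hxy : x ≤ y) :
    renyiBranch N j x ≤ renyiBranch N j y := by
  have hp := branch_denom_pos hN j hx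
  unfold renyiBranch
  gcongr

lemma abs_renyiBranch_sub_le {N : ℕ} (hN : 2 ≤ N) (j : ℕ) {x y : ℝ} (hx : 0 ≤ x) (hy : 0 ≤ y) :
    |renyiBranch N j y - renyiBranch N j x| ≤ N / ((j + N : ℕ) : ℝ) ^ 2 * |y - x| := by
  have h0 := branch_denom_pos hN j le_rfl
  have hpx := branch_denom_pos hN j hx
  have hpy := branch_denom_pos hN j hy
  rw [zero_add] at h0
  have heq : renyiBranch N j y - renyiBranch N j x =
      N / ((x + ((j + N : ℕ) : ℝ)) * (y + ((j + N : ℕ) : ℝ))) * (y - x) := by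
    unfold renyiBranch
    field_simp
    ring
  rw [heq, abs_mul, abs_of_nonneg (by positivity), sq]
  gcongr <;> linarith

lemma hasDerivAt_renyiBranch {N : ℕ} (hN : 2 ≤ N) (j : ℕ) {x : ℝ} (hx : 0 ≤ x) :
    HasDerivAt (renyiBranch N j) (N / (x + ((j + N : ℕ) : ℝ)) ^ 2) x := by
  have hp := branch_denom_pos hN j hx
  have h := ((hasDerivAt_const x (N : ℝ)).div
    ((hasDerivAt_id x).add_const ((j + N : ℕ) : ℝ)) hp.ne').const_sub 1
  exact h.congr_deriv (by simp; ring)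

lemma monotone_renyiBranch_zero {N : ℕ} (hN : 2 ≤ N) : Monotone fun j => renyiBranch N j 0 :=
  monotone_nat_of_le_succ fun j => by
    rw [← renyiBranch_one]
    exact renyiBranch_mono hN j le_rfl zero_le_one

/-- Away from the zeros of the Rényi-type map, its sublevel sets are unions of branch intervals. -/
lemma renyiMap_le_iff {N : ℕ} (hN : 2 ≤ N) {x z : ℝ} (hx : x ∈ Icc (0 : ℝ) 1) (hz : z ∈ Icc (0 : ℝ) 1)
    (hz0 : renyiMap N z ≠ 0) :
    renyiMap N z ≤ x ↔ ∃ j, z ∈ Ioc (renyiBranch N j 0) (renyiBranch N j x) := by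
  have hz1 : z ≠ 1 := by
    rintro rfl
    simp [renyiMap] at hz0
  have hpos : 0 < 1 - z := sub_pos.2 (lt_of_le_of_ne hz.2 hz1)
  have hNpos : (0 : ℝ) < N := by exact_mod_cast (by omega : 0 < N)
  have hR : renyiMap N z = Int.fract ((N : ℝ) / (1 - z)) := by simp [renyiMap, hz1]
  rw [hR] at hz0 ⊢
  set w := (N : ℝ) / (1 - z) with hw
  have hmem : ∀ j, z ∈ Ioc (renyiBranch N j 0) (renyiBranch N j x) ↔
      ((j + N : ℕ) : ℝ) < w ∧ w ≤ x + ((j + N : ℕ) : ℝ) := by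
    intro j
    have h0 := branch_denom_pos hN j le_rfl
    have hpx := branch_denom_pos hN j hx.1
    rw [zero_add] at h0
    have e1 : renyiBranch N j 0 < z ↔ ((j + N : ℕ) : ℝ) < w := by
      rw [renyiBranch, zero_add, sub_lt_comm, hw, lt_div_iff₀ hpos, lt_div_iff₀ h0, mul_comm]
    have e2 : z ≤ renyiBranch N j x ↔ w ≤ x + ((j + N : ℕ) : ℝ) := by
      rw [renyiBranch, le_sub_comm, hw, div_le_iff₀ hpos, div_le_iff₀ hpx, mul_comm]
    rw [mem_Ioc, e1, e2]
  simp only [hmem]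
  constructor
  · intro h
    have hwN : (N : ℝ) ≤ w := by
      rw [hw, le_div_iff₀ hpos]
      nlinarith [hz.1]
    have hfl : (N : ℤ) ≤ ⌊w⌋ := Int.le_floor.2 (by exact_mod_cast hwN)
    obtain ⟨j, hj⟩ := Int.eq_ofNat_of_zero_le (sub_nonneg.2 hfl)
    have hcast : ((j + N : ℕ) : ℝ) = ⌊w⌋ := by
      have : ((j + N : ℕ) : ℤ) = ⌊w⌋ := by push_cast; omega
      exact_mod_cast congrArg (Int.cast : ℤ → ℝ) this
    have hadd := Int.floor_add_fract w
    have hf : 0 < Int.fract w := lt_of_le_of_ne (Int.fract_nonneg w) (Ne.symm hz0)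
    exact ⟨j, by rw [hcast]; linarith, by rw [hcast]; linarith⟩
  · rintro ⟨j, h1, h2⟩
    rcases lt_or_ge w (((j + N : ℕ) : ℝ) + 1) with h | h
    · have hfl : ⌊w⌋ = ((j + N : ℕ) : ℤ) := by
        rw [Int.floor_eq_iff]
        exact ⟨by exact_mod_cast h1.le, by exact_mod_cast h⟩
      rw [Int.fract, hfl, Int.cast_natCast]
      linarith
    · refine absurd ?_ hz0
      have hwe : w = ((j + N + 1 : ℕ) : ℝ) := by
        have := hx.2
        push_cast at *
        linarith
      rw [hwe, Int.fract_natCast]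

lemma measurable_renyiMap (N : ℕ) : Measurable (renyiMap N) :=
  Measurable.ite (measurableSet_singleton 1) measurable_const (by fun_prop)

lemma renyiMap_mem_Icc (N : ℕ) (z : ℝ) : renyiMap N z ∈ Icc (0 : ℝ) 1 := by
  unfold renyiMap
  split_ifs
  · simp
  · exact ⟨Int.fract_nonneg _, (Int.fract_lt_one _).le⟩

lemma countable_renyiMap_preimage_singleton {N : ℕ} (hN : 2 ≤ N) (c : ℝ) :
    (renyiMap N ⁻¹' {c}).Countable := by
  refine ((countable_singleton (1 : ℝ)).union
    (countable_range fun k : ℤ => 1 - (N : ℝ) / (c + k))).mono ?_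
  intro z hz
  by_cases h1 : z = 1
  · exact Or.inl h1
  · right
    have hNne : (N : ℝ) ≠ 0 := by exact_mod_cast (by omega : N ≠ 0)
    have hf : Int.fract ((N : ℝ) / (1 - z)) = c := by simpa [renyiMap, h1] using hz
    refine ⟨⌊(N : ℝ) / (1 - z)⌋, ?_⟩
    have hne : 1 - z ≠ 0 := sub_ne_zero.2 (Ne.symm h1)
    have hck : c + ⌊(N : ℝ) / (1 - z)⌋ = N / (1 - z) := by
      rw [← hf, Int.fract_add_floor]
    simp only [hck]
    field_simp
    ring

lemma countable_iterate_preimage_singleton {N : ℕ} (hN : 2 ≤ N) (n : ℕ) (c : ℝ) :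
    ((renyiMap N)^[n] ⁻¹' {c}).Countable := by
  induction n generalizing c with
  | zero => simp
  | succ n ih =>
    rw [Function.iterate_succ', preimage_comp, ← biUnion_preimage_singleton]
    exact (countable_renyiMap_preimage_singleton hN c).biUnion fun d _ => ih d

/-- For a non-atomic law on `[0,1]`, the distribution function of the image under the Rényi-type
map is the sum of the increments over the branches. -/
lemma hasSum_real_renyiMap_le {N : ℕ} (hN : 2 ≤ N) (ν : Measure ℝ) [IsFiniteMeasure ν]
    (hν : ∀ c, ν {c} = 0) (hsupp : ∀ᵐ z ∂ν, z ∈ Icc (0 : ℝ) 1) {x : ℝ} (hx : x ∈ Icc (0 : ℝ) 1) :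
    HasSum (fun j => ν.real (Iic (renyiBranch N j x)) - ν.real (Iic (renyiBranch N j 0)))
      (ν.real {z | renyiMap N z ≤ x}) := by
  have : NullSingletonClass ν := ⟨hν⟩
  have hdisj : Pairwise (Function.onFun Disjoint
      fun j => Ioc (renyiBranch N j 0) (renyiBranch N j x)) := by
    intro i j hij
    refine ((monotone_renyiBranch_zero hN).pairwise_disjoint_on_Ioc_succ hij).mono ?_ ?_ <;>
    · refine Ioc_subset_Ioc_right ?_
      rw [Order.succ_eq_add_one, ← renyiBranch_one]
      exact renyiBranch_mono hN _ hx.1 hx.2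
  have hae : {z | renyiMap N z ≤ x} =ᵐ[ν] ⋃ j, Ioc (renyiBranch N j 0) (renyiBranch N j x) := by
    have hz0 : ∀ᵐ z ∂ν, renyiMap N z ≠ 0 :=
      measure_eq_zero_iff_ae_notMem.1
        ((countable_renyiMap_preimage_singleton hN 0).measure_zero ν)
    filter_upwards [hsupp, hz0] with z hz hz0
    refine propext ?_
    change renyiMap N z ≤ x ↔ z ∈ ⋃ j, Ioc (renyiBranch N j 0) (renyiBranch N j x)
    rw [mem_iUnion]
    exact renyiMap_le_iff hN hx hz hz0
  rw [measureReal_congr hae]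
  have hU := measure_iUnion (μ := ν) hdisj fun j => measurableSet_Ioc
  have hfin : ∑' j, ν (Ioc (renyiBranch N j 0) (renyiBranch N j x)) ≠ ⊤ :=
    hU ▸ measure_ne_top ν _
  have h := ENNReal.hasSum_toReal hfin
  rw [← ENNReal.tsum_toReal_eq fun j => measure_ne_top ν _, ← hU] at h
  refine h.congr_fun fun j => ?_
  change _ = ν.real _
  rw [← Iic_sdiff_Iic, measureReal_sdiff (Iic_subset_Iic.2 (renyiBranch_mono hN j le_rfl hx.1))
    measurableSet_Iic]

/-- The law of `R_N^n` under `μ` restricted to `[0,1]`. -/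
noncomputable def renyiLaw (N : ℕ) (μ : Measure ℝ) (n : ℕ) : Measure ℝ :=
  (μ.restrict (Icc 0 1)).map (renyiMap N)^[n]

lemma renyiLaw_real_apply (N : ℕ) (μ : Measure ℝ) (n : ℕ) {s : Set ℝ} (hs : MeasurableSet s) :
    (renyiLaw N μ n).real s = (μ {y ∈ Icc (0 : ℝ) 1 | (renyiMap N)^[n] y ∈ s}).toReal := by
  have hm := (measurable_renyiMap N).iterate n
  rw [Measure.real, renyiLaw, Measure.map_apply hm hs, Measure.restrict_apply (hm hs), inter_comm]
  rfl

lemma hasSum_Fdist_succ {N : ℕ} (hN : 2 ≤ N) (μ : Measure ℝ) [IsProbabilityMeasure μ]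
    [NullSingletonClass μ] (n : ℕ) {x : ℝ} (hx : x ∈ Icc (0 : ℝ) 1) :
    HasSum (fun j => Fdist N μ n (renyiBranch N j x) - Fdist N μ n (renyiBranch N j 0))
      (Fdist N μ (n + 1) x) := by
  have hm := (measurable_renyiMap N).iterate n
  have hfin : IsFiniteMeasure (renyiLaw N μ n) := by unfold renyiLaw; infer_instance
  have hatom : ∀ c, renyiLaw N μ n {c} = 0 := fun c => by
    rw [renyiLaw, Measure.map_apply hm (measurableSet_singleton c)]
    exact (countable_iterate_preimage_singleton hN n c).measure_zero _
  have hsupp : ∀ᵐ z ∂(renyiLaw N μ n), z ∈ Icc (0 : ℝ) 1 := by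
    refine (ae_map_iff hm.aemeasurable measurableSet_Icc).2 ?_
    filter_upwards [ae_restrict_mem measurableSet_Icc] with y hy
    cases n with
    | zero => exact hy
    | succ n =>
      rw [Function.iterate_succ_apply']
      exact renyiMap_mem_Icc N _
  have h := hasSum_real_renyiMap_le hN (renyiLaw N μ n) hatom hsupp hx
  rw [renyiLaw_real_apply N μ n (measurableSet_le (measurable_renyiMap N) measurable_const)] at h
  simp only [renyiLaw_real_apply N μ n measurableSet_Iic] at h
  simpa only [Fdist, Function.iterate_succ_apply', mem_Iic, mem_ofPred_eq] using h

/-- Lipschitz bound for the increments of `F` along a branch. -/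
lemma abs_branch_increment_le {N : ℕ} (hN : 2 ≤ N) {F : ℝ → ℝ} {M : ℝ} (hM : 0 ≤ M)
    (hF : ∀ a ∈ Icc (0 : ℝ) 1, ∀ b ∈ Icc (0 : ℝ) 1, |F b - F a| ≤ M * |b - a|)
    (j : ℕ) {x y : ℝ} (hx : x ∈ Icc (0 : ℝ) 1) (hy : y ∈ Icc (0 : ℝ) 1) :
    |F (renyiBranch N j y) - F (renyiBranch N j x)| ≤
      M * (N / ((j + N : ℕ) : ℝ) ^ 2) * |y - x| := by
  rw [mul_assoc]
  exact (hF _ (renyiBranch_mem_Icc hN j hx) _ (renyiBranch_mem_Icc hN j hy)).trans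
    (mul_le_mul_of_nonneg_left (abs_renyiBranch_sub_le hN j hx.1 hy.1) hM)

lemma hasDerivWithinAt_Fdist_succ {N : ℕ} (hN : 2 ≤ N) (μ : Measure ℝ) [IsProbabilityMeasure μ]
    [NullSingletonClass μ] (n : ℕ) (hd : DifferentiableOn ℝ (Fdist N μ n) (Icc 0 1)) {M : ℝ}
    (hM : 0 ≤ M) (hF : ∀ a ∈ Icc (0 : ℝ) 1, ∀ b ∈ Icc (0 : ℝ) 1,
      |Fdist N μ n b - Fdist N μ n a| ≤ M * |b - a|) {x : ℝ} (hx : x ∈ Icc (0 : ℝ) 1) :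
    HasDerivWithinAt (Fdist N μ (n + 1))
      (∑' j : ℕ, derivWithin (Fdist N μ n) (Icc 0 1) (renyiBranch N j x) *
        (N / (x + ((j + N : ℕ) : ℝ)) ^ 2)) (Icc 0 1) x := by
  refine HasDerivWithinAt.congr_of_mem (f := fun y => ∑' j,
      (Fdist N μ n (renyiBranch N j y) - Fdist N μ n (renyiBranch N j 0))) ?_
    (fun y hy => (hasSum_Fdist_succ hN μ n hy).tsum_eq.symm) hx
  refine hasDerivWithinAt_tsum_of_lipschitz hx ((summable_branch_const N).mul_left M)
    (fun y hy => (hasSum_Fdist_succ hN μ n hy).summable) (fun j y hy => ?_) (fun j => ?_)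
  · rw [sub_sub_sub_cancel_right]
    exact abs_branch_increment_le hN hM hF j hx hy
  · exact ((hd _ (renyiBranch_mem_Icc hN j hx)).hasDerivWithinAt.comp x
      (hasDerivAt_renyiBranch hN j hx.1).hasDerivWithinAt
      (fun y hy => renyiBranch_mem_Icc hN j hy)).sub_const _

lemma Fdist_succ_lipschitz {N : ℕ} (hN : 2 ≤ N) (μ : Measure ℝ) [IsProbabilityMeasure μ]
    [NullSingletonClass μ] (n : ℕ) {M : ℝ} (hM : 0 ≤ M)
    (hF : ∀ a ∈ Icc (0 : ℝ) 1, ∀ b ∈ Icc (0 : ℝ) 1,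
      |Fdist N μ n b - Fdist N μ n a| ≤ M * |b - a|) :
    ∀ a ∈ Icc (0 : ℝ) 1, ∀ b ∈ Icc (0 : ℝ) 1, |Fdist N μ (n + 1) b - Fdist N μ (n + 1) a| ≤
      (∑' j : ℕ, M * (N / ((j + N : ℕ) : ℝ) ^ 2)) * |b - a| := by
  intro a ha b hb
  have h := (hasSum_Fdist_succ hN μ n hb).sub (hasSum_Fdist_succ hN μ n ha)
  simp only [sub_sub_sub_cancel_right] at h
  rw [← h.tsum_eq, ← Real.norm_eq_abs]
  exact tsum_of_norm_bounded (((summable_branch_const N).mul_left M).hasSum.mul_right _)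
    fun j => abs_branch_increment_le hN hM hF j ha hb

lemma Fdist_differentiableOn_and_lipschitz {N : ℕ} (hN : 2 ≤ N) (μ : Measure ℝ)
    [IsProbabilityMeasure μ] [NullSingletonClass μ]
    (hdiff : DifferentiableOn ℝ (Fdist N μ 0) (Icc 0 1))
    (hbdd : ∃ M : ℝ, ∀ x ∈ Icc (0 : ℝ) 1, |derivWithin (Fdist N μ 0) (Icc 0 1) x| ≤ M) (n : ℕ) :
    DifferentiableOn ℝ (Fdist N μ n) (Icc 0 1) ∧ ∃ M : ℝ, 0 ≤ M ∧
      ∀ a ∈ Icc (0 : ℝ) 1, ∀ b ∈ Icc (0 : ℝ) 1,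
        |Fdist N μ n b - Fdist N μ n a| ≤ M * |b - a| := by
  induction n with
  | zero =>
    obtain ⟨M, hM⟩ := hbdd
    exact ⟨hdiff, M, (abs_nonneg _).trans (hM 0 (by simp)), fun a ha b hb =>
      (convex_Icc (0 : ℝ) 1).norm_image_sub_le_of_norm_derivWithin_le hdiff hM ha hb⟩
  | succ n ih =>
    obtain ⟨hd, M, hM, hF⟩ := ih
    exact ⟨fun x hx => (hasDerivWithinAt_Fdist_succ hN μ n hd hM hF hx).differentiableWithinAt,
      _, tsum_nonneg fun j => by positivity, Fdist_succ_lipschitz hN μ n hM hF⟩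

/-- `f_{N,n+1}(x) = ∑_{i ≥ N} P_{N,i}(x) f_{N,n}(u_{N,i}(x))`, where
`P_{N,i}(x) = (x+N-1)/((x+i)(x+i-1))` and `u_{N,i}(x) = 1 - N/(x+i)`
(sum via `i = j + N`). -/
theorem fDens_recurrence (N : ℕ) (hN : 2 ≤ N) (μ : Measure ℝ)
    [IsProbabilityMeasure μ] [NullSingletonClass μ] (hsupp : μ (Icc (0 : ℝ) 1)ᶜ = 0)
    (hdiff : DifferentiableOn ℝ (Fdist N μ 0) (Icc 0 1))
    (hbdd : ∃ M : ℝ, ∀ x ∈ Icc (0 : ℝ) 1,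
      |derivWithin (Fdist N μ 0) (Icc 0 1) x| ≤ M) :
    ∀ n : ℕ, ∀ x ∈ Icc (0 : ℝ) 1,
      fDens N μ (n + 1) x =
        ∑' j : ℕ,
          (x + N - 1) / ((x + ((j + N : ℕ) : ℝ)) * (x + ((j + N : ℕ) : ℝ) - 1)) *
            fDens N μ n (1 - (N : ℝ) / (x + ((j + N : ℕ) : ℝ))) := by
  intro n x hx
  obtain ⟨hd, M, hM, hF⟩ := Fdist_differentiableOn_and_lipschitz hN μ hdiff hbdd n
  rw [fDens, (hasDerivWithinAt_Fdist_succ hN μ n hd hM hF hx).derivWithin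
    (uniqueDiffOn_Icc_zero_one x hx), ← tsum_mul_left]
  refine tsum_congr fun j => ?_
  have hp := branch_denom_pos hN j hx.1
  have hp' : 0 < x + ((j + N : ℕ) : ℝ) - 1 := by
    have : (2 : ℝ) ≤ ((j + N : ℕ) : ℝ) := by exact_mod_cast (by omega : 2 ≤ j + N)
    linarith [hx.1]
  rw [fDens, ← renyiBranch]
  have hu : renyiBranch N j x + N - 1 =
      N * (x + ((j + N : ℕ) : ℝ) - 1) / (x + ((j + N : ℕ) : ℝ)) := by
    unfold renyiBranch
    field_simp
    ring
  rw [hu]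
  field_simp
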